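/- (Exactness of the first relaxation, Lemma 2.) Let p be a bivariate polynomial of degree 4, C = {x ∈ ℝ² : p(x) = 0} nonempty, and suppose P = conv(C) is compact. If for every affine polynomial f(x) = f₀ + f₁x₁ + f₂x₂ with f ≥ 0 on P there exists c ∈ ℝ such that f(x) − c·p(x) ≥ 0 for all x ∈ ℝ², then P = P₂, i.e. the first Lasserre relaxation is exact (P is semidefinite representable with at most 12 lifting variables). -/

import Mathlib

/-- Evaluation of a bivariate polynomial of degree at most 4, given by its
coefficients `c i j` of the monomials `x₁^i * x₂^j`. -/
noncomputable def evalPoly (c : ℕ → ℕ → ℝ) (x : ℝ × ℝ) : ℝ :=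
  ∑ i ∈ Finset.range 5, ∑ j ∈ Finset.range 5, c i j * x.1 ^ i * x.2 ^ j

/-- The six monomials of degree at most 2 indexing the moment matrix. -/
def momIdx : Fin 6 → ℕ × ℕ := ![(0,0), (1,0), (0,1), (2,0), (1,1), (0,2)]

/-- The 6×6 moment matrix `M(y)` with entries `M_{(a,b),(c,d)} = y_{a+c,b+d}`. -/
def momMat (y : ℕ → ℕ → ℝ) : Matrix (Fin 6) (Fin 6) ℝ :=
  Matrix.of fun a b => y ((momIdx a).1 + (momIdx b).1) ((momIdx a).2 + (momIdx b).2)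

/-- The first Lasserre relaxation `P₂` of `conv {x : p(x) = 0}`. -/
def lasserre2 (c : ℕ → ℕ → ℝ) : Set (ℝ × ℝ) :=
  {x | ∃ y : ℕ → ℕ → ℝ, y 0 0 = 1 ∧ y 1 0 = x.1 ∧ y 0 1 = x.2 ∧
    (∑ i ∈ Finset.range 5, ∑ j ∈ Finset.range 5, c i j * y i j) = 0 ∧
    (momMat y).PosSemidef}

/-- `q` is a ternary quadratic form. -/
def IsTernaryQuadratic (q : ℝ → ℝ → ℝ → ℝ) : Prop :=
  ∃ a b c d e f : ℝ, ∀ x y z, q x y z =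
    a * x ^ 2 + b * y ^ 2 + c * z ^ 2 + d * (x * y) + e * (x * z) + f * (y * z)

/-- `F` is a ternary quartic form. -/
def IsTernaryQuartic (F : ℝ → ℝ → ℝ → ℝ) : Prop :=
  ∃ a₀ a₁ a₂ a₃ a₄ a₅ a₆ a₇ a₈ a₉ b₀ b₁ b₂ b₃ b₄ : ℝ, ∀ x y z, F x y z =
    a₀ * x ^ 4 + a₁ * (x ^ 3 * y) + a₂ * (x ^ 3 * z)
    + a₃ * (x ^ 2 * y ^ 2) + a₄ * (x ^ 2 * (y * z)) + a₅ * (x ^ 2 * z ^ 2)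
    + a₆ * (x * y ^ 3) + a₇ * (x * y * (y * z)) + a₈ * (x * y * z ^ 2) + a₉ * (x * z ^ 3)
    + b₀ * y ^ 4 + b₁ * (y ^ 3 * z) + b₂ * (y ^ 2 * z ^ 2) + b₃ * (y * z ^ 3) + b₄ * z ^ 4

/-- `F` dominates a positive multiple of the square of a nonzero quadratic form. -/
def DominatesSquare (F : ℝ → ℝ → ℝ → ℝ) : Prop :=
  ∃ q, IsTernaryQuadratic q ∧ (∃ x y z, q x y z ≠ 0) ∧
    ∃ ε > 0, ∀ x y z, ε * q x y z ^ 2 ≤ F x y z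

section Forms

theorem IsTernaryQuadratic.linear_mul_linear (a b c d e f : ℝ) :
    IsTernaryQuadratic fun x y z => (a * x + b * y + c * z) * (d * x + e * y + f * z) :=
  ⟨a * d, b * e, c * f, a * e + b * d, a * f + c * d, b * f + c * e, fun x y z => by ring⟩

theorem IsTernaryQuadratic.add {p q : ℝ → ℝ → ℝ → ℝ} (hp : IsTernaryQuadratic p)
    (hq : IsTernaryQuadratic q) : IsTernaryQuadratic fun x y z => p x y z + q x y z := by
  obtain ⟨a, b, c, d, e, f, hp⟩ := hp
  obtain ⟨a', b', c', d', e', f', hq⟩ := hq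
  exact ⟨a + a', b + b', c + c', d + d', e + e', f + f', fun x y z => by
    simp only [hp, hq]; ring⟩

theorem IsTernaryQuadratic.const_mul {q : ℝ → ℝ → ℝ → ℝ} (r : ℝ) (hq : IsTernaryQuadratic q) :
    IsTernaryQuadratic fun x y z => r * q x y z := by
  obtain ⟨a, b, c, d, e, f, hq⟩ := hq
  exact ⟨r * a, r * b, r * c, r * d, r * e, r * f, fun x y z => by simp only [hq]; ring⟩

theorem IsTernaryQuadratic.mul {p q : ℝ → ℝ → ℝ → ℝ} (hp : IsTernaryQuadratic p)
    (hq : IsTernaryQuadratic q) : IsTernaryQuartic fun x y z => p x y z * q x y z := by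
  obtain ⟨a, b, c, d, e, f, hp⟩ := hp
  obtain ⟨a', b', c', d', e', f', hq⟩ := hq
  exact ⟨a * a', a * d' + d * a', a * e' + e * a', a * b' + b * a' + d * d',
    a * f' + f * a' + d * e' + e * d', a * c' + c * a' + e * e', b * d' + d * b',
    b * e' + e * b' + d * f' + f * d', c * d' + d * c' + e * f' + f * e', c * e' + e * c',
    b * b', b * f' + f * b', b * c' + c * b' + f * f', c * f' + f * c', c * c',
    fun x y z => by simp only [hp, hq]; ring⟩

theorem IsTernaryQuartic.add {F G : ℝ → ℝ → ℝ → ℝ} (hF : IsTernaryQuartic F)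
    (hG : IsTernaryQuartic G) : IsTernaryQuartic fun x y z => F x y z + G x y z := by
  obtain ⟨a₀, a₁, a₂, a₃, a₄, a₅, a₆, a₇, a₈, a₉, b₀, b₁, b₂, b₃, b₄, hF⟩ := hF
  obtain ⟨c₀, c₁, c₂, c₃, c₄, c₅, c₆, c₇, c₈, c₉, d₀, d₁, d₂, d₃, d₄, hG⟩ := hG
  exact ⟨a₀ + c₀, a₁ + c₁, a₂ + c₂, a₃ + c₃, a₄ + c₄, a₅ + c₅, a₆ + c₆, a₇ + c₇, a₈ + c₈,
    a₉ + c₉, b₀ + d₀, b₁ + d₁, b₂ + d₂, b₃ + d₃, b₄ + d₄, fun x y z => by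
    simp only [hF, hG]; ring⟩

theorem IsTernaryQuartic.const_mul {F : ℝ → ℝ → ℝ → ℝ} (r : ℝ) (hF : IsTernaryQuartic F) :
    IsTernaryQuartic fun x y z => r * F x y z := by
  obtain ⟨a₀, a₁, a₂, a₃, a₄, a₅, a₆, a₇, a₈, a₉, b₀, b₁, b₂, b₃, b₄, hF⟩ := hF
  exact ⟨r * a₀, r * a₁, r * a₂, r * a₃, r * a₄, r * a₅, r * a₆, r * a₇, r * a₈, r * a₉,
    r * b₀, r * b₁, r * b₂, r * b₃, r * b₄, fun x y z => by simp only [hF]; ring⟩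

theorem IsTernaryQuartic.sum {ι : Type*} (s : Finset ι) {F : ι → ℝ → ℝ → ℝ → ℝ}
    (hF : ∀ i ∈ s, IsTernaryQuartic (F i)) :
    IsTernaryQuartic fun x y z => ∑ i ∈ s, F i x y z := by
  classical
  induction s using Finset.induction_on with
  | empty => exact ⟨0, 0, 0, 0, 0, 0, 0, 0, 0, 0, 0, 0, 0, 0, 0, fun x y z => by simp⟩
  | insert i s hi ih =>
    simp only [Finset.sum_insert hi]
    exact (hF i (Finset.mem_insert_self i s)).add
      (ih fun j hj => hF j (Finset.mem_insert_of_mem hj))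

theorem IsTernaryQuadratic.comp_linear {q : ℝ → ℝ → ℝ → ℝ} (hq : IsTernaryQuadratic q)
    (a b c d e f g h k : ℝ) :
    IsTernaryQuadratic fun x y z =>
      q (a * x + b * y + c * z) (d * x + e * y + f * z) (g * x + h * y + k * z) := by
  obtain ⟨q₁, q₂, q₃, q₄, q₅, q₆, hq⟩ := hq
  simp only [hq, pow_two]
  exact ((((((linear_mul_linear _ _ _ _ _ _).const_mul _).add
    ((linear_mul_linear _ _ _ _ _ _).const_mul _)).add
    ((linear_mul_linear _ _ _ _ _ _).const_mul _)).add
    ((linear_mul_linear _ _ _ _ _ _).const_mul _)).add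
    ((linear_mul_linear _ _ _ _ _ _).const_mul _)).add
    ((linear_mul_linear _ _ _ _ _ _).const_mul _)

theorem IsTernaryQuartic.comp_linear {F : ℝ → ℝ → ℝ → ℝ} (hF : IsTernaryQuartic F)
    (a b c d e f g h k : ℝ) :
    IsTernaryQuartic fun x y z =>
      F (a * x + b * y + c * z) (d * x + e * y + f * z) (g * x + h * y + k * z) := by
  obtain ⟨a₀, a₁, a₂, a₃, a₄, a₅, a₆, a₇, a₈, a₉, b₀, b₁, b₂, b₃, b₄, hF⟩ := hF
  have key : ∀ r u₁ u₂ u₃ u₄ u₅ u₆ v₁ v₂ v₃ v₄ v₅ v₆ : ℝ, IsTernaryQuartic fun x y z =>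
      r * (((u₁ * x + u₂ * y + u₃ * z) * (u₄ * x + u₅ * y + u₆ * z)) *
        ((v₁ * x + v₂ * y + v₃ * z) * (v₄ * x + v₅ * y + v₆ * z))) := fun r _ _ _ _ _ _ _ _ _ _ _ _ =>
    ((IsTernaryQuadratic.linear_mul_linear _ _ _ _ _ _).mul
      (IsTernaryQuadratic.linear_mul_linear _ _ _ _ _ _)).const_mul r
  have h := ((((((((((((((key a₀ a b c a b c a b c a b c).add
    (key a₁ a b c a b c a b c d e f)).add (key a₂ a b c a b c a b c g h k)).add
    (key a₃ a b c a b c d e f d e f)).add (key a₄ a b c a b c d e f g h k)).add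
    (key a₅ a b c a b c g h k g h k)).add (key a₆ a b c d e f d e f d e f)).add
    (key a₇ a b c d e f d e f g h k)).add (key a₈ a b c d e f g h k g h k)).add
    (key a₉ a b c g h k g h k g h k)).add (key b₀ d e f d e f d e f d e f)).add
    (key b₁ d e f d e f d e f g h k)).add (key b₂ d e f d e f g h k g h k)).add
    (key b₃ d e f g h k g h k g h k)).add (key b₄ g h k g h k g h k g h k)
  convert h using 4
  rw [hF]
  ring

theorem IsTernaryQuartic.smul {F : ℝ → ℝ → ℝ → ℝ} (hF : IsTernaryQuartic F) (t x y z : ℝ) :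
    F (t * x) (t * y) (t * z) = t ^ 4 * F x y z := by
  obtain ⟨a₀, a₁, a₂, a₃, a₄, a₅, a₆, a₇, a₈, a₉, b₀, b₁, b₂, b₃, b₄, hF⟩ := hF
  simp only [hF]
  ring

theorem IsTernaryQuartic.continuous {F : ℝ → ℝ → ℝ → ℝ} (hF : IsTernaryQuartic F) :
    Continuous fun v : ℝ × ℝ × ℝ => F v.1 v.2.1 v.2.2 := by
  obtain ⟨a₀, a₁, a₂, a₃, a₄, a₅, a₆, a₇, a₈, a₉, b₀, b₁, b₂, b₃, b₄, hF⟩ := hF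
  simp only [hF]
  fun_prop

theorem DominatesSquare.of_comp_linear {F : ℝ → ℝ → ℝ → ℝ} {a b c d e f g h k : ℝ}
    (hdet : a * (e * k - f * h) - b * (d * k - f * g) + c * (d * h - e * g) ≠ 0)
    (hF : DominatesSquare fun x y z =>
      F (a * x + b * y + c * z) (d * x + e * y + f * z) (g * x + h * y + k * z)) :
    DominatesSquare F := by
  obtain ⟨q, hq, ⟨x₀, y₀, z₀, hne⟩, ε, hε, hle⟩ := hF
  set δ := a * (e * k - f * h) - b * (d * k - f * g) + c * (d * h - e * g) with hδ
  refine ⟨_, hq.comp_linear ((e * k - f * h) / δ) ((c * h - b * k) / δ) ((b * f - c * e) / δ)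
    ((f * g - d * k) / δ) ((a * k - c * g) / δ) ((c * d - a * f) / δ)
    ((d * h - e * g) / δ) ((b * g - a * h) / δ) ((a * e - b * d) / δ),
    ⟨a * x₀ + b * y₀ + c * z₀, d * x₀ + e * y₀ + f * z₀, g * x₀ + h * y₀ + k * z₀, ?_⟩,
    ε, hε, fun x y z => (hle _ _ _).trans_eq ?_⟩
  · convert hne using 2 <;> field_simp <;> rw [hδ] <;> ring
  · dsimp only
    congr 1 <;> field_simp <;> rw [hδ] <;> ring

theorem exists_ne_zero_comp_linear {F : ℝ → ℝ → ℝ → ℝ} {a b c d e f g h k : ℝ}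
    (hdet : a * (e * k - f * h) - b * (d * k - f * g) + c * (d * h - e * g) ≠ 0)
    (hne : ∃ x y z, F x y z ≠ 0) :
    ∃ x y z, F (a * x + b * y + c * z) (d * x + e * y + f * z) (g * x + h * y + k * z) ≠ 0 := by
  obtain ⟨x, y, z, hne⟩ := hne
  set δ := a * (e * k - f * h) - b * (d * k - f * g) + c * (d * h - e * g) with hδ
  refine ⟨((e * k - f * h) * x + (c * h - b * k) * y + (b * f - c * e) * z) / δ,
    ((f * g - d * k) * x + (a * k - c * g) * y + (c * d - a * f) * z) / δ,
    ((d * h - e * g) * x + (b * g - a * h) * y + (a * e - b * d) * z) / δ, ?_⟩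
  convert hne using 2 <;> field_simp <;> rw [hδ] <;> ring

/-- To show that a nonnegative quartic form dominates a square, one may change the basis. -/
theorem DominatesSquare.of_change_basis {F : ℝ → ℝ → ℝ → ℝ} (hF : IsTernaryQuartic F)
    (hpsd : ∀ x y z, 0 ≤ F x y z) (hne : ∃ x y z, F x y z ≠ 0) {a b c d e f g h k : ℝ}
    (hdet : a * (e * k - f * h) - b * (d * k - f * g) + c * (d * h - e * g) ≠ 0)
    (H : ∀ G : ℝ → ℝ → ℝ → ℝ, IsTernaryQuartic G → (∀ x y z, 0 ≤ G x y z) →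
      (∃ x y z, G x y z ≠ 0) → (∀ x y z, G x y z =
        F (a * x + b * y + c * z) (d * x + e * y + f * z) (g * x + h * y + k * z)) →
      DominatesSquare G) : DominatesSquare F :=
  .of_comp_linear hdet <| H _ (hF.comp_linear a b c d e f g h k) (fun _ _ _ => hpsd _ _ _)
    (exists_ne_zero_comp_linear hdet hne) fun _ _ _ => rfl

end Forms

section RealAnalysis

theorem nonneg_at_zero_of_nonneg_on_pos {φ : ℝ → ℝ} (hφ : Continuous φ)
    (h : ∀ t > 0, 0 ≤ φ t) : 0 ≤ φ 0 := by
  have hlim : Filter.Tendsto φ (nhdsWithin 0 (Set.Ioi 0)) (nhds (φ 0)) :=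
    hφ.continuousAt.tendsto.mono_left nhdsWithin_le_nhds
  exact ge_of_tendsto hlim (by filter_upwards [self_mem_nhdsWithin] with t ht using h t ht)

theorem linear_coeff_eq_zero {a b c d : ℝ}
    (h : ∀ t : ℝ, 0 ≤ a * t + b * t ^ 2 + c * t ^ 3 + d * t ^ 4) : a = 0 := by
  apply le_antisymm
  · have := nonneg_at_zero_of_nonneg_on_pos
      (φ := fun t => -(a + b * (-t) + c * (-t) ^ 2 + d * (-t) ^ 3)) (by fun_prop) fun t ht => by
        have := h (-t)
        exact nonneg_of_mul_nonneg_right (by linarith) ht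
    simp at this
    linarith
  · have := nonneg_at_zero_of_nonneg_on_pos
      (φ := fun t => a + b * t + c * t ^ 2 + d * t ^ 3) (by fun_prop) fun t ht => by
        have := h t
        exact nonneg_of_mul_nonneg_right (by linarith) ht
    simpa using this

theorem sq_le_mul_of_quadratic_nonneg {f g h : ℝ} (H : ∀ x : ℝ, 0 ≤ f * x ^ 2 + 2 * g * x + h) :
    g ^ 2 ≤ f * h := by
  have := discrim_le_zero (a := f) (b := 2 * g) (c := h) fun x => by linarith [H x]
  unfold discrim at this
  linarith

theorem leading_nonneg_of_quadratic_nonneg {f g h : ℝ}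
    (H : ∀ x : ℝ, 0 ≤ f * x ^ 2 + 2 * g * x + h) : 0 ≤ f := by
  have hh : 0 ≤ h := by simpa using H 0
  rcases hh.eq_or_lt with rfl | hh
  · have := H 1
    have := H (-1)
    linarith
  · exact nonneg_of_mul_nonneg_left (by nlinarith [sq_le_mul_of_quadratic_nonneg H]) hh

/-- Two positively homogeneous continuous functions of the same degree, the first one positive. -/
theorem exists_pos_mul_le_of_homogeneous {E : Type*} [NormedAddCommGroup E] [NormedSpace ℝ E]
    [ProperSpace E] {P Q : E → ℝ} (hP : Continuous P) (hQ : Continuous Q) {n : ℕ} (hn : n ≠ 0)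
    (hPn : ∀ (t : ℝ) v, P (t • v) = t ^ n * P v) (hQn : ∀ (t : ℝ) v, Q (t • v) = t ^ n * Q v)
    (hpos : ∀ v, v ≠ 0 → 0 < P v) : ∃ ε > 0, ∀ v, ε * Q v ≤ P v := by
  have hzero : ∀ ε, ε * Q 0 ≤ P 0 := fun ε => by
    have h₁ := hPn 0 0
    have h₂ := hQn 0 0
    simp [hn] at h₁ h₂
    simp [h₁, h₂]
  have hcpt : IsCompact (Metric.sphere (0 : E) 1) := isCompact_sphere 0 1
  rcases (Metric.sphere (0 : E) 1).eq_empty_or_nonempty with hemp | hS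
  · refine ⟨1, one_pos, fun v => ?_⟩
    by_cases hv : v = 0
    · exact hv ▸ hzero 1
    · have : ‖v‖⁻¹ • v ∈ Metric.sphere (0 : E) 1 := by simp [norm_smul, hv]
      simp [hemp] at this
  · obtain ⟨u, hu, hmin⟩ := hcpt.exists_isMinOn hS hP.continuousOn
    obtain ⟨w, hw, hmax⟩ := hcpt.exists_isMaxOn hS hQ.continuousOn
    have hu0 : u ≠ 0 := by rintro rfl; simp at hu
    have hM : 0 < |Q w| + 1 := by positivity
    refine ⟨P u / (|Q w| + 1), div_pos (hpos u hu0) hM, fun v => ?_⟩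
    by_cases hv : v = 0
    · exact hv ▸ hzero _
    · have hmem : ‖v‖⁻¹ • v ∈ Metric.sphere (0 : E) 1 := by simp [norm_smul, hv]
      have hv' : v = ‖v‖ • (‖v‖⁻¹ • v) := by simp [hv]
      have h₁ : P u ≤ P (‖v‖⁻¹ • v) := hmin hmem
      have h₂ : Q (‖v‖⁻¹ • v) ≤ Q w := hmax hmem
      have h₃ : P u / (|Q w| + 1) * Q (‖v‖⁻¹ • v) ≤ P (‖v‖⁻¹ • v) := by
        refine le_trans ?_ h₁
        rw [div_mul_eq_mul_div, div_le_iff₀ hM]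
        exact mul_le_mul_of_nonneg_left (by linarith [le_abs_self (Q w)]) (hpos u hu0).le
      rw [hv', hPn, hQn]
      nlinarith [pow_nonneg (norm_nonneg v) n]

end RealAnalysis

section Zeros

theorem exists_linear_sq_le {α β γ : ℝ} (hpsd : ∀ y z : ℝ, 0 ≤ α * y ^ 2 + β * (y * z) + γ * z ^ 2)
    (hne : ∃ y z : ℝ, α * y ^ 2 + β * (y * z) + γ * z ^ 2 ≠ 0) :
    ∃ l m : ℝ, (l ≠ 0 ∨ m ≠ 0) ∧ ∃ ε > 0, ∀ y z : ℝ,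
      ε * (l * y + m * z) ^ 2 ≤ α * y ^ 2 + β * (y * z) + γ * z ^ 2 := by
  have hdisc : (β / 2) ^ 2 ≤ α * γ :=
    sq_le_mul_of_quadratic_nonneg fun y => by linarith [hpsd y 1]
  have hα : 0 ≤ α := by simpa using hpsd 1 0
  have hγ : 0 ≤ γ := by simpa using hpsd 0 1
  rcases hα.eq_or_lt with rfl | hα
  · have hβ : β = 0 := by nlinarith
    subst hβ
    obtain ⟨y, z, hyz⟩ := hne
    have hγ' : γ ≠ 0 := by rintro rfl; simp at hyz
    exact ⟨0, 1, by simp, γ, lt_of_le_of_ne hγ hγ'.symm, fun y z => by nlinarith⟩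
  · refine ⟨α, β / 2, Or.inl hα.ne', 1 / α, by positivity, fun y z => ?_⟩
    rw [div_mul_eq_mul_div, div_le_iff₀ hα]
    nlinarith [mul_nonneg (sub_nonneg.2 hdisc) (sq_nonneg z)]

theorem exists_normal_form {F : ℝ → ℝ → ℝ → ℝ} (hF : IsTernaryQuartic F)
    (hpsd : ∀ x y z, 0 ≤ F x y z) (hzero : F 1 0 0 = 0) :
    ∃ α β γ g₀ g₁ g₂ g₃ h₀ h₁ h₂ h₃ h₄ : ℝ, ∀ x y z, F x y z =
      (α * y ^ 2 + β * (y * z) + γ * z ^ 2) * x ^ 2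
      + 2 * (g₀ * y ^ 3 + g₁ * (y ^ 2 * z) + g₂ * (y * z ^ 2) + g₃ * z ^ 3) * x
      + (h₀ * y ^ 4 + h₁ * (y ^ 3 * z) + h₂ * (y ^ 2 * z ^ 2) + h₃ * (y * z ^ 3)
        + h₄ * z ^ 4) := by
  obtain ⟨a₀, a₁, a₂, a₃, a₄, a₅, a₆, a₇, a₈, a₉, b₀, b₁, b₂, b₃, b₄, hF⟩ := hF
  have e₀ : a₀ = 0 := by simpa [hF] using hzero
  have e₁ : a₁ = 0 := linear_coeff_eq_zero (b := a₃) (c := a₆) (d := b₀) fun t => by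
    have := hpsd 1 t 0
    simp only [hF, e₀] at this
    linarith
  have e₂ : a₂ = 0 := linear_coeff_eq_zero (b := a₅) (c := a₉) (d := b₄) fun t => by
    have := hpsd 1 0 t
    simp only [hF, e₀] at this
    linarith
  refine ⟨a₃, a₄, a₅, a₆ / 2, a₇ / 2, a₈ / 2, a₉ / 2, b₀, b₁, b₂, b₃, b₄, fun x y z => ?_⟩
  rw [hF, e₀, e₁, e₂]
  ring

theorem nonneg_of_binary_quartic_zero {h₀ h₁ h₂ h₃ h₄ : ℝ}
    (hpsd : ∀ y z : ℝ, 0 ≤ h₀ * y ^ 4 + h₁ * (y ^ 3 * z) + h₂ * (y ^ 2 * z ^ 2)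
      + h₃ * (y * z ^ 3) + h₄ * z ^ 4)
    (hzero : h₄ = 0) :
    h₃ = 0 ∧ ∀ y z : ℝ, 0 ≤ h₀ * y ^ 2 + h₁ * (y * z) + h₂ * z ^ 2 := by
  have e₃ : h₃ = 0 := linear_coeff_eq_zero (b := h₂) (c := h₁) (d := h₀) fun t => by
    have := hpsd t 1
    simp only [hzero] at this
    linarith
  have key : ∀ y z : ℝ, y ≠ 0 → 0 ≤ h₀ * y ^ 2 + h₁ * (y * z) + h₂ * z ^ 2 := fun y z hy => by
    have := hpsd y z
    simp only [hzero, e₃] at this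
    exact nonneg_of_mul_nonneg_right (a := y ^ 2) (by linarith) (by positivity)
  refine ⟨e₃, fun y z => ?_⟩
  by_cases hy : y = 0
  · subst hy
    exact nonneg_at_zero_of_nonneg_on_pos
      (φ := fun t => h₀ * t ^ 2 + h₁ * (t * z) + h₂ * z ^ 2) (by fun_prop)
      fun t ht => key t z ht.ne'
  · exact key y z hy

theorem exists_pos_mul_le_of_homogeneous₂ {P Q : ℝ → ℝ → ℝ}
    (hP : Continuous fun v : ℝ × ℝ => P v.1 v.2) (hQ : Continuous fun v : ℝ × ℝ => Q v.1 v.2)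
    {n : ℕ} (hn : n ≠ 0) (hPn : ∀ t y z : ℝ, P (t * y) (t * z) = t ^ n * P y z)
    (hQn : ∀ t y z : ℝ, Q (t * y) (t * z) = t ^ n * Q y z)
    (hpos : ∀ y z : ℝ, (y ≠ 0 ∨ z ≠ 0) → 0 < P y z) :
    ∃ ε > 0, ∀ y z, ε * Q y z ≤ P y z := by
  obtain ⟨ε, hε, h⟩ := exists_pos_mul_le_of_homogeneous hP hQ hn
    (fun t v => by simpa using hPn t v.1 v.2) (fun t v => by simpa using hQn t v.1 v.2)
    (fun v hv => hpos _ _ (by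
      by_contra! h
      exact hv (Prod.ext h.1 h.2)))
  exact ⟨ε, hε, fun y z => h (y, z)⟩

theorem dominatesSquare_of_binary {F : ℝ → ℝ → ℝ → ℝ} {h₀ h₁ h₂ h₃ h₄ : ℝ}
    (hF : ∀ x y z, F x y z = h₀ * y ^ 4 + h₁ * (y ^ 3 * z) + h₂ * (y ^ 2 * z ^ 2)
      + h₃ * (y * z ^ 3) + h₄ * z ^ 4)
    (hpsd : ∀ x y z, 0 ≤ F x y z) (hne : ∃ x y z, F x y z ≠ 0) : DominatesSquare F := by
  by_cases hpos : ∀ y z : ℝ, (y ≠ 0 ∨ z ≠ 0) → 0 < F 0 y z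
  · obtain ⟨ε, hε, h⟩ := exists_pos_mul_le_of_homogeneous₂ (P := F 0)
      (Q := fun y z => (y ^ 2) ^ 2) (n := 4) (by simp only [hF]; fun_prop) (by fun_prop)
      (by simp) (by intros; simp only [hF]; ring) (by intros; ring) hpos
    exact ⟨fun x y z => y ^ 2, ⟨0, 1, 0, 0, 0, 0, fun x y z => by ring⟩, ⟨0, 1, 0, by simp⟩,
      ε, hε, fun x y z => (h y z).trans_eq (by simp only [hF])⟩
  · push Not at hpos
    obtain ⟨b, c, hbc, hle⟩ := hpos
    have hbc' : b ^ 2 + c ^ 2 ≠ 0 := by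
      rcases hbc with h | h <;> positivity
    have hq : IsTernaryQuartic F := ⟨0, 0, 0, 0, 0, 0, 0, 0, 0, 0, h₀, h₁, h₂, h₃, h₄,
      fun x y z => by rw [hF]; ring⟩
    refine .of_change_basis hq hpsd hne (a := 1) (b := 0) (c := 0) (d := 0) (e := c) (f := b)
      (g := 0) (h := -b) (k := c) (by convert hbc' using 1; ring)
      fun G hG hG_psd ⟨x₀, y₀, z₀, hG_ne⟩ hGF => ?_
    obtain ⟨a₀, a₁, a₂, a₃, a₄, a₅, a₆, a₇, a₈, a₉, k₀, k₁, k₂, k₃, k₄, hk⟩ := hG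
    have hk' : ∀ x y z, G x y z = k₀ * y ^ 4 + k₁ * (y ^ 3 * z)
        + k₂ * (y ^ 2 * z ^ 2) + k₃ * (y * z ^ 3) + k₄ * z ^ 4 := fun x y z => by
      have h₁ := hk 0 y z
      rw [hGF, hF] at h₁
      rw [hGF, hF]
      linarith
    have hk₄ : k₄ = 0 := by
      have h₁ := hk' 0 0 1
      have h₂ := hpsd 0 b c
      simp [hGF] at h₁
      linarith
    obtain ⟨hk₃, hk_psd⟩ :=
      nonneg_of_binary_quartic_zero (fun y z => by rw [← hk' 0]; exact hG_psd _ _ _) hk₄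
    have hval : ∀ x y z, G x y z = y ^ 2 * (k₀ * y ^ 2 + k₁ * (y * z) + k₂ * z ^ 2) :=
      fun x y z => by rw [hk', hk₃, hk₄]; ring
    rw [hval] at hG_ne
    obtain ⟨l, m, hlm, ε, hε, hle'⟩ :=
      exists_linear_sq_le hk_psd ⟨y₀, z₀, right_ne_zero_of_mul hG_ne⟩
    refine ⟨fun x y z => y * (l * y + m * z), ⟨0, l, 0, 0, 0, m, fun x y z => by ring⟩, ?_,
      ε, hε, fun x y z => ?_⟩
    · by_cases hl : l = 0
      · exact ⟨0, 1, 1, by simpa [hl] using hlm⟩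
      · exact ⟨0, 1, 0, by simpa using hl⟩
    · rw [hval]
      nlinarith [mul_le_mul_of_nonneg_left (hle' y z) (sq_nonneg y)]

/-- A nonnegative form with a zero at `(1, 0, 0)` at which the Hessian is singular. -/
theorem dominatesSquare_of_singular {F : ℝ → ℝ → ℝ → ℝ} (hF : IsTernaryQuartic F)
    (hpsd : ∀ x y z, 0 ≤ F x y z) (hne : ∃ x y z, F x y z ≠ 0) (hzero : F 1 0 0 = 0)
    {b c : ℝ} (hbc : b ≠ 0 ∨ c ≠ 0) (hsing : F 1 b c + F (-1) b c - 2 * F 0 b c = 0) :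
    DominatesSquare F := by
  have hbc' : b ^ 2 + c ^ 2 ≠ 0 := by
    rcases hbc with h | h <;> positivity
  refine .of_change_basis hF hpsd hne (a := 1) (b := 0) (c := 0) (d := 0) (e := c) (f := b)
    (g := 0) (h := -b) (k := c) (by convert hbc' using 1; ring) fun G hF' hpsd' hne' hGF => ?_
  have hsing' : G 1 0 1 + G (-1) 0 1 - 2 * G 0 0 1 = 0 := by simpa [hGF] using hsing
  have hzero' : G 1 0 0 = 0 := by simpa [hGF] using hzero
  clear hGF hF hpsd hne hzero hsing
  obtain ⟨α, β, γ, g₀, g₁, g₂, g₃, h₀, h₁, h₂, h₃, h₄, hform⟩ :=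
    exists_normal_form hF' hpsd' hzero'
  have hγ : γ = 0 := by
    simp only [hform] at hsing'
    linarith
  have hquad : ∀ y z x : ℝ, 0 ≤ (α * y ^ 2 + β * (y * z) + γ * z ^ 2) * x ^ 2
      + 2 * (g₀ * y ^ 3 + g₁ * (y ^ 2 * z) + g₂ * (y * z ^ 2) + g₃ * z ^ 3) * x
      + (h₀ * y ^ 4 + h₁ * (y ^ 3 * z) + h₂ * (y ^ 2 * z ^ 2) + h₃ * (y * z ^ 3)
        + h₄ * z ^ 4) := fun y z x => by
    rw [← hform]; exact hpsd' x y z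
  have hf := fun y z => leading_nonneg_of_quadratic_nonneg (hquad y z)
  have hD := fun y z => sq_le_mul_of_quadratic_nonneg (hquad y z)
  have hβ : β = 0 := linear_coeff_eq_zero (b := α) (c := 0) (d := 0) fun t => by
    have := hf t 1
    rw [hγ] at this
    linarith
  have hα : 0 ≤ α := by simpa using hf 1 0
  rcases hα.eq_or_lt with hα | hα
  · have hg : ∀ y z : ℝ, g₀ * y ^ 3 + g₁ * (y ^ 2 * z) + g₂ * (y * z ^ 2) + g₃ * z ^ 3 = 0 :=
      fun y z => by
        have := hD y z
        rw [← hα, hβ, hγ] at this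
        nlinarith
    refine dominatesSquare_of_binary (h₀ := h₀) (h₁ := h₁) (h₂ := h₂) (h₃ := h₃) (h₄ := h₄)
      (fun x y z => ?_) hpsd' hne'
    rw [hform, hg, ← hα, hβ, hγ]
    ring
  · have hg₃ : g₃ = 0 := by
      have := hD 0 1
      rw [hβ, hγ] at this
      nlinarith
    have key₁ : ∀ y z : ℝ, y ≠ 0 → (g₀ * y ^ 2 + g₁ * (y * z) + g₂ * z ^ 2) ^ 2 ≤
        α * (h₀ * y ^ 4 + h₁ * (y ^ 3 * z) + h₂ * (y ^ 2 * z ^ 2) + h₃ * (y * z ^ 3)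
        + h₄ * z ^ 4) := fun y z hy => by
      have := hD y z
      rw [hβ, hγ, hg₃] at this
      exact le_of_mul_le_mul_left (a := y ^ 2) (by linarith) (by positivity)
    have key : ∀ y z : ℝ, (g₀ * y ^ 2 + g₁ * (y * z) + g₂ * z ^ 2) ^ 2 ≤
        α * (h₀ * y ^ 4 + h₁ * (y ^ 3 * z) + h₂ * (y ^ 2 * z ^ 2) + h₃ * (y * z ^ 3)
        + h₄ * z ^ 4) := fun y z => by
      by_cases hy : y = 0
      · subst hy
        exact sub_nonneg.1 (nonneg_at_zero_of_nonneg_on_pos (φ := fun y =>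
          α * (h₀ * y ^ 4 + h₁ * (y ^ 3 * z) + h₂ * (y ^ 2 * z ^ 2) + h₃ * (y * z ^ 3)
          + h₄ * z ^ 4) - (g₀ * y ^ 2 + g₁ * (y * z) + g₂ * z ^ 2) ^ 2) (by fun_prop)
          fun t ht => sub_nonneg.2 (key₁ t z ht.ne'))
      · exact key₁ y z hy
    refine ⟨fun x y z => α * (x * y) + (g₀ * y ^ 2 + g₁ * (y * z) + g₂ * z ^ 2),
      ⟨0, g₀, g₂, α, 0, g₁, fun x y z => by ring⟩, ?_, 1 / α, by positivity, fun x y z => ?_⟩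
    · by_cases h : α * (1 * 1) + (g₀ * 1 ^ 2 + g₁ * (1 * 0) + g₂ * 0 ^ 2) = 0
      · refine ⟨2, 1, 0, ?_⟩
        intro h'
        linarith
      · exact ⟨1, 1, 0, h⟩
    · rw [div_mul_eq_mul_div, div_le_iff₀ hα, hform, hβ, hγ, hg₃]
      nlinarith [key y z]

theorem exists_linear_factor {A B C b c : ℝ} (hbc : b ≠ 0 ∨ c ≠ 0)
    (h : A * b ^ 2 + B * (b * c) + C * c ^ 2 = 0) :
    ∃ l m : ℝ, ∀ y z : ℝ,
      A * y ^ 2 + B * (y * z) + C * z ^ 2 = (c * y - b * z) * (l * y + m * z) := by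
  by_cases hc : c = 0
  · subst hc
    have hb : b ≠ 0 := by simpa using hbc
    have hA : A = 0 := by simpa [hb] using h
    refine ⟨-B / b, -C / b, fun y z => ?_⟩
    rw [hA]
    field_simp
    ring
  · refine ⟨A / c, (B * c + b * A) / c ^ 2, fun y z => ?_⟩
    field_simp
    linear_combination z ^ 2 * h

theorem exists_mul_sq_of_nonneg_of_zero {A B C b c : ℝ} (hbc : b ≠ 0 ∨ c ≠ 0)
    (hpsd : ∀ y z : ℝ, 0 ≤ A * y ^ 2 + B * (y * z) + C * z ^ 2)
    (h : A * b ^ 2 + B * (b * c) + C * c ^ 2 = 0) :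
    ∃ ρ ≥ 0, ∀ y z : ℝ,
      A * y ^ 2 + B * (y * z) + C * z ^ 2 = ρ * (c * y - b * z) ^ 2 := by
  have hbc' : 0 < b ^ 2 + c ^ 2 := by
    rcases hbc with h | h <;> positivity
  have hA : 0 ≤ A := by simpa using hpsd 1 0
  have hC : 0 ≤ C := by simpa using hpsd 0 1
  have hdisc : (B / 2) ^ 2 ≤ A * C :=
    sq_le_mul_of_quadratic_nonneg fun y => by linarith [hpsd y 1]
  have e₁ : 2 * A * b + B * c = 0 := by
    have : (2 * A * b + B * c) ^ 2 ≤ 0 := by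
      nlinarith [mul_nonneg (sub_nonneg.2 hdisc) (sq_nonneg c)]
    nlinarith
  have e₂ : B * b + 2 * C * c = 0 := by
    have : (B * b + 2 * C * c) ^ 2 ≤ 0 := by
      nlinarith [mul_nonneg (sub_nonneg.2 hdisc) (sq_nonneg b)]
    nlinarith
  refine ⟨(A + C) / (b ^ 2 + c ^ 2), by positivity, fun y z => ?_⟩
  field_simp
  linear_combination (b * y ^ 2 / 2 + c * y * z - b * z ^ 2 / 2) * e₁
    + (-c * y ^ 2 / 2 + b * y * z + c * z ^ 2 / 2) * e₂

theorem dominatesSquare_of_two_zeros {F : ℝ → ℝ → ℝ → ℝ} (hF : IsTernaryQuartic F)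
    (hpsd : ∀ x y z, 0 ≤ F x y z) (hne : ∃ x y z, F x y z ≠ 0) (hzero₁ : F 1 0 0 = 0)
    (hzero₂ : F 0 1 0 = 0) : DominatesSquare F := by
  by_cases hsing : ∃ b c : ℝ, (b ≠ 0 ∨ c ≠ 0) ∧ F 1 b c + F (-1) b c - 2 * F 0 b c = 0
  · obtain ⟨b, c, hbc, h⟩ := hsing
    exact dominatesSquare_of_singular hF hpsd hne hzero₁ hbc h
  push Not at hsing
  obtain ⟨α, β, γ, g₀, g₁, g₂, g₃, h₀, h₁, h₂, h₃, h₄, hform⟩ :=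
    exists_normal_form hF hpsd hzero₁
  have e₀ : h₀ = 0 := by simpa [hform] using hzero₂
  have e₁ : g₀ = 0 := by
    have := linear_coeff_eq_zero (a := 2 * g₀) (b := α) (c := 0) (d := 0) fun t => by
      have := hpsd t 1 0
      simp only [hform, e₀] at this
      linarith
    linarith
  have e₂ : h₁ = 0 := linear_coeff_eq_zero (b := h₂) (c := h₃) (d := h₄) fun t => by
    have := hpsd 0 1 t
    simp only [hform, e₀] at this
    linarith
  obtain ⟨f, hf⟩ : ∃ f : ℝ → ℝ → ℝ, f = fun y z => α * y ^ 2 + β * (y * z) + γ * z ^ 2 :=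
    ⟨_, rfl⟩
  obtain ⟨g, hg⟩ : ∃ g : ℝ → ℝ → ℝ, g = fun y z => g₁ * y ^ 2 + g₂ * (y * z) + g₃ * z ^ 2 :=
    ⟨_, rfl⟩
  obtain ⟨h, hh⟩ : ∃ h : ℝ → ℝ → ℝ, h = fun y z => h₂ * y ^ 2 + h₃ * (y * z) + h₄ * z ^ 2 :=
    ⟨_, rfl⟩
  have hFval : ∀ x y z, F x y z = f y z * x ^ 2 + 2 * (z * g y z) * x + z ^ 2 * h y z :=
    fun x y z => by
      simp only [hform, e₀, e₁, e₂, hf, hg, hh]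
      ring
  have hquad : ∀ y z x, 0 ≤ f y z * x ^ 2 + 2 * (z * g y z) * x + z ^ 2 * h y z :=
    fun y z x => by rw [← hFval]; exact hpsd x y z
  have hf_nonneg : ∀ y z, 0 ≤ f y z := fun y z => leading_nonneg_of_quadratic_nonneg (hquad y z)
  have hf_pos : ∀ y z, (y ≠ 0 ∨ z ≠ 0) → 0 < f y z := fun y z hyz =>
    (hf_nonneg y z).lt_of_ne fun h0 => hsing y z hyz (by rw [hFval, hFval, hFval, ← h0]; ring)
  have hD : ∀ y z, 0 ≤ f y z * h y z - g y z ^ 2 := by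
    have key : ∀ y z : ℝ, z ≠ 0 → 0 ≤ f y z * h y z - g y z ^ 2 := fun y z hz => by
      have := sq_le_mul_of_quadratic_nonneg (hquad y z)
      exact nonneg_of_mul_nonneg_right (a := z ^ 2) (by linarith) (by positivity)
    intro y z
    by_cases hz : z = 0
    · subst hz
      exact nonneg_at_zero_of_nonneg_on_pos (φ := fun z => f y z * h y z - g y z ^ 2)
        (by simp only [hf, hg, hh]; fun_prop) fun t ht => key y t ht.ne'
    · exact key y z hz
  by_cases hD_pos : ∀ y z, (y ≠ 0 ∨ z ≠ 0) → 0 < f y z * h y z - g y z ^ 2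
  · obtain ⟨ε, hε, hle⟩ := exists_pos_mul_le_of_homogeneous₂
      (P := fun y z => f y z * h y z - g y z ^ 2) (Q := fun y z => z ^ 2 * f y z) (n := 4)
      (by simp only [hf, hg, hh]; fun_prop) (by simp only [hf]; fun_prop)
      (by simp) (by intros; simp only [hf, hg, hh]; ring) (by intros; simp only [hf]; ring) hD_pos
    refine ⟨fun x y z => z ^ 2, ⟨0, 0, 1, 0, 0, 0, fun x y z => by ring⟩, ⟨0, 0, 1, by simp⟩,
      ε, hε, fun x y z => ?_⟩
    by_cases hz : z = 0
    · simpa [hz] using hpsd x y 0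
    · have hfp := hf_pos y z (Or.inr hz)
      refine le_of_mul_le_mul_left ?_ hfp
      rw [hFval]
      nlinarith [mul_le_mul_of_nonneg_left (hle y z) (sq_nonneg z),
        sq_nonneg (f y z * x + z * g y z)]
  · push Not at hD_pos
    obtain ⟨b, c, hbc, hle⟩ := hD_pos
    have hD₀ : f b c * h b c - g b c ^ 2 = 0 := le_antisymm hle (hD b c)
    have hfp := hf_pos b c hbc
    obtain ⟨k, hk⟩ : ∃ k, k = -(g b c) / f b c := ⟨_, rfl⟩
    have hk' : g b c + k * f b c = 0 := by
      rw [hk]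
      field_simp
      ring
    have hh_zero : h b c + 2 * k * g b c + k ^ 2 * f b c = 0 := by
      refine (mul_eq_zero.1 ?_).resolve_left hfp.ne'
      linear_combination hD₀ + (g b c + k * f b c) * hk'
    have hh'_nonneg : ∀ y z, 0 ≤ h y z + 2 * k * g y z + k ^ 2 * f y z := fun y z => by
      by_cases hyz : y ≠ 0 ∨ z ≠ 0
      · refine nonneg_of_mul_nonneg_right (a := f y z) ?_ (hf_pos y z hyz)
        nlinarith [hD y z, sq_nonneg (g y z + k * f y z)]
      · push Not at hyz
        simp [hf, hg, hh, hyz]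
    obtain ⟨ρ, hρ, hρ_eq⟩ := exists_mul_sq_of_nonneg_of_zero (A := h₂ + 2 * k * g₁ + k ^ 2 * α)
      (B := h₃ + 2 * k * g₂ + k ^ 2 * β) (C := h₄ + 2 * k * g₃ + k ^ 2 * γ) hbc
      (fun y z => by
        have := hh'_nonneg y z
        simp only [hf, hg, hh] at this
        linarith)
      (by
        simp only [hf, hg, hh] at hh_zero
        linarith)
    obtain ⟨l, m, hlm⟩ := exists_linear_factor (A := g₁ + k * α) (B := g₂ + k * β)
      (C := g₃ + k * γ) hbc (by
        simp only [hf, hg] at hk'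
        linarith)
    have hh' : ∀ y z, h y z = ρ * (c * y - b * z) ^ 2 - 2 * k * g y z - k ^ 2 * f y z :=
      fun y z => by
        rw [← hρ_eq]
        simp only [hf, hg, hh]
        ring
    have hg' : ∀ y z, g y z = (c * y - b * z) * (l * y + m * z) - k * f y z := fun y z => by
      rw [← hlm]
      simp only [hf, hg]
      ring
    have hG₁ : ∀ y z, c * y - b * z ≠ 0 → (l * y + m * z) ^ 2 ≤ ρ * f y z := fun y z hyz => by
      refine le_of_mul_le_mul_left (a := (c * y - b * z) ^ 2) ?_ (by positivity)
      have := hD y z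
      rw [hh', hg'] at this
      linarith
    have hG : ∀ y z, (l * y + m * z) ^ 2 ≤ ρ * f y z := fun y z => by
      by_cases hyz : c * y - b * z = 0
      · have := nonneg_at_zero_of_nonneg_on_pos (φ := fun t =>
          ρ * f (y + t * c) (z - t * b) - (l * (y + t * c) + m * (z - t * b)) ^ 2)
          (by simp only [hf]; fun_prop) fun t ht => sub_nonneg.2 (hG₁ _ _ (by
            have : c * (y + t * c) - b * (z - t * b) = t * (b ^ 2 + c ^ 2) := by
              linear_combination hyz
            rw [this]
            rcases hbc with h | h <;> positivity))
        simpa using this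
      · exact hG₁ y z hyz
    have hFval' : ∀ x y z, F x y z = f y z * (x - k * z) ^ 2
        + 2 * (x - k * z) * z * ((c * y - b * z) * (l * y + m * z))
        + ρ * (z * (c * y - b * z)) ^ 2 := fun x y z => by
      rw [hFval, hh', hg']
      ring
    rcases hρ.lt_or_eq with hρ | hρ
    · refine ⟨fun x y z => ρ * (z * (c * y - b * z)) + (x - k * z) * (l * y + m * z),
        ⟨0, 0, -ρ * b - k * m, l, m, ρ * c - k * l, fun x y z => by ring⟩, ?_,
        1 / ρ, by positivity, fun x y z => ?_⟩
      · by_cases hc : c = 0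
        · have hb : b ≠ 0 := by simpa [hc] using hbc
          exact ⟨k, 0, 1, by simp [hb, hρ.ne']⟩
        · refine ⟨k, (b + 1) / c, 1, ?_⟩
          have : c * ((b + 1) / c) - b = 1 := by field_simp; ring
          simp [this, hρ.ne']
      · rw [div_mul_eq_mul_div, div_le_iff₀ hρ, hFval']
        nlinarith [mul_le_mul_of_nonneg_left (hG y z) (sq_nonneg (x - k * z))]
    · subst hρ
      obtain ⟨l', m', hlm', ε, hε, hle'⟩ := exists_linear_sq_le
        (fun y z => by simpa only [hf] using hf_nonneg y z)
        ⟨1, 0, by simpa only [hf] using (hf_pos 1 0 (by simp)).ne'⟩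
      refine ⟨fun x y z => (x - k * z) * (l' * y + m' * z),
        ⟨0, 0, -k * m', l', m', -k * l', fun x y z => by ring⟩, ?_, ε, hε, fun x y z => ?_⟩
      · by_cases hl : l' = 0
        · refine ⟨k + 1, 0, 1, ?_⟩
          simpa [hl] using hlm'
        · exact ⟨1, 1, 0, by simpa using hl⟩
      · have h0 : l * y + m * z = 0 := by
          have := hG y z
          nlinarith
        have h1 : ε * (l' * y + m' * z) ^ 2 ≤ f y z := by simpa only [hf] using hle' y z
        rw [hFval', h0]
        nlinarith [mul_le_mul_of_nonneg_left h1 (sq_nonneg (x - k * z))]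

theorem dominatesSquare_of_zero {F : ℝ → ℝ → ℝ → ℝ} (hF : IsTernaryQuartic F)
    (hpsd : ∀ x y z, 0 ≤ F x y z) (hne : ∃ x y z, F x y z ≠ 0) (hzero : F 1 0 0 = 0) :
    DominatesSquare F := by
  by_cases hsing : ∃ b c : ℝ, (b ≠ 0 ∨ c ≠ 0) ∧ F 1 b c + F (-1) b c - 2 * F 0 b c = 0
  · obtain ⟨b, c, hbc, h⟩ := hsing
    exact dominatesSquare_of_singular hF hpsd hne hzero hbc h
  push Not at hsing
  by_cases htwo : ∃ a b c : ℝ, (b ≠ 0 ∨ c ≠ 0) ∧ F a b c = 0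
  · obtain ⟨a, b, c, hbc, habc⟩ := htwo
    have hbc' : b ^ 2 + c ^ 2 ≠ 0 := by
      rcases hbc with h | h <;> positivity
    refine .of_change_basis hF hpsd hne (a := 1) (b := a) (c := 0) (d := 0) (e := b) (f := -c)
      (g := 0) (h := c) (k := b) (by convert hbc' using 1; ring) fun G hG hG_psd hG_ne hGF =>
      dominatesSquare_of_two_zeros hG hG_psd hG_ne (by simpa [hGF] using hzero)
        (by simpa [hGF] using habc)
  push Not at htwo
  obtain ⟨α, β, γ, g₀, g₁, g₂, g₃, h₀, h₁, h₂, h₃, h₄, hform⟩ :=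
    exists_normal_form hF hpsd hzero
  obtain ⟨f, hf⟩ : ∃ f : ℝ → ℝ → ℝ, f = fun y z => α * y ^ 2 + β * (y * z) + γ * z ^ 2 :=
    ⟨_, rfl⟩
  obtain ⟨g, hg⟩ : ∃ g : ℝ → ℝ → ℝ, g = fun y z =>
    g₀ * y ^ 3 + g₁ * (y ^ 2 * z) + g₂ * (y * z ^ 2) + g₃ * z ^ 3 := ⟨_, rfl⟩
  obtain ⟨h, hh⟩ : ∃ h : ℝ → ℝ → ℝ, h = fun y z => h₀ * y ^ 4 + h₁ * (y ^ 3 * z)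
    + h₂ * (y ^ 2 * z ^ 2) + h₃ * (y * z ^ 3) + h₄ * z ^ 4 := ⟨_, rfl⟩
  have hFval : ∀ x y z, F x y z = f y z * x ^ 2 + 2 * g y z * x + h y z :=
    fun x y z => by simp only [hform, hf, hg, hh]
  have hquad : ∀ y z x, 0 ≤ f y z * x ^ 2 + 2 * g y z * x + h y z :=
    fun y z x => by rw [← hFval]; exact hpsd x y z
  have hf_pos : ∀ y z, (y ≠ 0 ∨ z ≠ 0) → 0 < f y z := fun y z hyz =>
    (leading_nonneg_of_quadratic_nonneg (hquad y z)).lt_of_ne fun h0 =>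
      hsing y z hyz (by rw [hFval, hFval, hFval, ← h0]; ring)
  have hD_pos : ∀ y z, (y ≠ 0 ∨ z ≠ 0) → 0 < f y z * h y z - g y z ^ 2 := fun y z hyz => by
    have hfp := hf_pos y z hyz
    refine (sub_nonneg.2 (sq_le_mul_of_quadratic_nonneg (hquad y z))).lt_of_ne fun h0 =>
      htwo (-(g y z) / f y z) y z hyz ?_
    rw [hFval]
    field_simp
    linarith
  obtain ⟨ε, hε, hle⟩ := exists_pos_mul_le_of_homogeneous₂
    (P := fun y z => f y z * h y z - g y z ^ 2) (Q := fun y z => f y z ^ 3) (n := 6)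
    (by simp only [hf, hg, hh]; fun_prop) (by simp only [hf]; fun_prop)
    (by simp) (by intros; simp only [hf, hg, hh]; ring) (by intros; simp only [hf]; ring) hD_pos
  refine ⟨fun x y z => f y z, ⟨0, α, γ, 0, 0, β, fun x y z => by simp only [hf]; ring⟩,
    ⟨0, 1, 0, (hf_pos 1 0 (by simp)).ne'⟩, ε, hε, fun x y z => ?_⟩
  by_cases hyz : y ≠ 0 ∨ z ≠ 0
  · refine le_of_mul_le_mul_left ?_ (hf_pos y z hyz)
    rw [hFval]
    nlinarith [hle y z, sq_nonneg (f y z * x + g y z)]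
  · push Not at hyz
    simpa [hf, hyz] using hpsd x 0 0

/-- A nonzero nonnegative ternary quartic form dominates the square of a nonzero quadratic form. -/
theorem IsTernaryQuartic.dominatesSquare {F : ℝ → ℝ → ℝ → ℝ} (hF : IsTernaryQuartic F)
    (hpsd : ∀ x y z, 0 ≤ F x y z) (hne : ∃ x y z, F x y z ≠ 0) : DominatesSquare F := by
  by_cases hzero : ∃ a b c : ℝ, (a, b, c) ≠ 0 ∧ F a b c = 0
  · obtain ⟨a, b, c, habc, h⟩ := hzero
    by_cases hab : a = 0 ∧ b = 0
    · have hc : c ≠ 0 := fun hc => habc (by simp [hab, hc])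
      refine .of_change_basis hF hpsd hne (a := 0) (b := 0) (c := 1) (d := 0) (e := 1) (f := 0)
        (g := c) (h := 0) (k := 0) (by simpa using hc) fun G hG hG_psd hG_ne hGF =>
        dominatesSquare_of_zero hG hG_psd hG_ne (by simpa [hGF, hab] using h)
    · have hab' : a ^ 2 + b ^ 2 ≠ 0 := by
        rcases not_and_or.1 hab with h | h <;> positivity
      refine .of_change_basis hF hpsd hne (a := a) (b := -b) (c := 0) (d := b) (e := a) (f := 0)
        (g := c) (h := 0) (k := 1) (by convert hab' using 1; ring) fun G hG hG_psd hG_ne hGF =>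
        dominatesSquare_of_zero hG hG_psd hG_ne (by simpa [hGF] using h)
  · push Not at hzero
    obtain ⟨ε, hε, hle⟩ := exists_pos_mul_le_of_homogeneous (E := ℝ × ℝ × ℝ)
      (P := fun v => F v.1 v.2.1 v.2.2) (Q := fun v => (v.1 ^ 2) ^ 2) (n := 4) hF.continuous
      (by fun_prop) (by simp) (fun t v => by simpa using hF.smul t _ _ _)
      (fun t v => by simp; ring) fun v hv => (hpsd _ _ _).lt_of_ne' (hzero _ _ _ hv)
    exact ⟨fun x y z => x ^ 2, ⟨1, 0, 0, 0, 0, 0, fun x y z => by ring⟩, ⟨1, 0, 0, by simp⟩,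
      ε, hε, fun x y z => hle (x, y, z)⟩

end Zeros

section Gram

open Matrix

/-- The homogenized monomials indexing the moment matrix. -/
def quadMonomials (x y z : ℝ) : Fin 6 → ℝ := ![z ^ 2, x * z, y * z, x ^ 2, x * y, y ^ 2]

theorem isTernaryQuadratic_quadMonomials (i : Fin 6) :
    IsTernaryQuadratic fun x y z => quadMonomials x y z i := by
  fin_cases i
  · exact ⟨0, 0, 1, 0, 0, 0, fun x y z => by simp [quadMonomials]⟩
  · exact ⟨0, 0, 0, 0, 1, 0, fun x y z => by simp [quadMonomials]⟩
  · exact ⟨0, 0, 0, 0, 0, 1, fun x y z => by simp [quadMonomials]⟩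
  · exact ⟨1, 0, 0, 0, 0, 0, fun x y z => by simp [quadMonomials]⟩
  · exact ⟨0, 0, 0, 1, 0, 0, fun x y z => by simp [quadMonomials]⟩
  · exact ⟨0, 1, 0, 0, 0, 0, fun x y z => by simp [quadMonomials]⟩

theorem isTernaryQuartic_gram (A : Matrix (Fin 6) (Fin 6) ℝ) :
    IsTernaryQuartic fun x y z => quadMonomials x y z ⬝ᵥ A *ᵥ quadMonomials x y z := by
  have h : IsTernaryQuartic fun x y z =>
      ∑ i, ∑ j, A i j * (quadMonomials x y z i * quadMonomials x y z j) :=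
    IsTernaryQuartic.sum _ fun i _ => IsTernaryQuartic.sum _ fun j _ =>
      ((isTernaryQuadratic_quadMonomials i).mul (isTernaryQuadratic_quadMonomials j)).const_mul _
  convert h using 4
  simp only [dotProduct, mulVec, Finset.mul_sum]
  exact Finset.sum_congr rfl fun i _ => Finset.sum_congr rfl fun j _ => by ring

theorem Matrix.PosSemidef.abs_apply_le {n : Type*} [Fintype n] [DecidableEq n]
    {A : Matrix n n ℝ} (hA : A.PosSemidef) {K : ℝ} (hK : ∀ i, A i i ≤ K) (i j : n) :
    |A i j| ≤ K := by
  have hsymm : A j i = A i j := by simpa using hA.isHermitian.apply i j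
  have h₁ := hA.dotProduct_mulVec_nonneg (Pi.single i 1 + Pi.single j 1)
  have h₂ := hA.dotProduct_mulVec_nonneg (Pi.single i 1 - Pi.single j 1)
  simp [mulVec_add, mulVec_sub, add_dotProduct, sub_dotProduct] at h₁ h₂
  rw [abs_le]
  constructor <;> linarith [hK i, hK j]

theorem isClosed_setOf_posSemidef {n : Type*} [Fintype n] :
    IsClosed {A : Matrix n n ℝ | A.PosSemidef} := by
  simp only [posSemidef_iff_dotProduct_mulVec, IsHermitian, Set.ofPred_and, Set.ofPred_forall]
  exact (isClosed_eq (by fun_prop) continuous_id).inter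
    (isClosed_iInter fun x => isClosed_le continuous_const (by fun_prop))

theorem isCompact_gram_le (F : ℝ → ℝ → ℝ → ℝ) :
    IsCompact {A : Matrix (Fin 6) (Fin 6) ℝ | A.PosSemidef ∧
      ∀ x y z, quadMonomials x y z ⬝ᵥ A *ᵥ quadMonomials x y z ≤ F x y z} := by
  set K := |F 1 0 0| + |F 0 1 0| + |F 0 0 1| + (|F 1 0 1| + |F 1 0 (-1)|)
    + (|F 1 1 0| + |F 1 (-1) 0|) + (|F 0 1 1| + |F 0 1 (-1)|) with hK
  refine (isCompact_univ_pi fun _ : Fin 6 => isCompact_univ_pi fun _ : Fin 6 =>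
    isCompact_Icc (a := -K) (b := K)).of_isClosed_subset ?_ ?_
  · simp only [Set.ofPred_and, Set.ofPred_forall]
    exact isClosed_setOf_posSemidef.inter (isClosed_iInter fun x => isClosed_iInter fun y =>
      isClosed_iInter fun z => isClosed_le (by fun_prop) continuous_const)
  · rintro A ⟨hA, hle⟩
    simp only [Set.mem_pi, Set.mem_univ, forall_const]
    refine fun i j => abs_le.1 (hA.abs_apply_le (fun i => ?_) i j)
    have q₁ := hA.dotProduct_mulVec_nonneg ![1, 0, 0, 1, 0, 0]
    have q₂ := hA.dotProduct_mulVec_nonneg ![1, 0, 0, 0, 0, 1]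
    have q₃ := hA.dotProduct_mulVec_nonneg ![0, 0, 0, 1, 0, 1]
    have p₁ := (hle 1 0 0).trans (le_abs_self _)
    have p₂ := (hle 0 1 0).trans (le_abs_self _)
    have p₃ := (hle 0 0 1).trans (le_abs_self _)
    have p₄ := (hle 1 0 1).trans (le_abs_self _)
    have p₅ := (hle 1 0 (-1)).trans (le_abs_self _)
    have p₆ := (hle 1 1 0).trans (le_abs_self _)
    have p₇ := (hle 1 (-1) 0).trans (le_abs_self _)
    have p₈ := (hle 0 1 1).trans (le_abs_self _)
    have p₉ := (hle 0 1 (-1)).trans (le_abs_self _)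
    simp [quadMonomials, dotProduct, mulVec, Fin.sum_univ_six] at q₁ q₂ q₃ p₁ p₂ p₃ p₄ p₅ p₆ p₇ p₈ p₉
    have n₁ := abs_nonneg (F 1 0 0)
    have n₂ := abs_nonneg (F 0 1 0)
    have n₃ := abs_nonneg (F 0 0 1)
    have n₄ := abs_nonneg (F 1 0 1)
    have n₅ := abs_nonneg (F 1 0 (-1))
    have n₆ := abs_nonneg (F 1 1 0)
    have n₇ := abs_nonneg (F 1 (-1) 0)
    have n₈ := abs_nonneg (F 0 1 1)
    have n₉ := abs_nonneg (F 0 1 (-1))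
    fin_cases i <;> dsimp <;> linarith

/-- Hilbert's theorem: a nonnegative ternary quartic form has a positive semidefinite Gram
matrix, so it is a sum of squares. -/
theorem IsTernaryQuartic.exists_posSemidef_gram {F : ℝ → ℝ → ℝ → ℝ} (hF : IsTernaryQuartic F)
    (hpsd : ∀ x y z, 0 ≤ F x y z) : ∃ A : Matrix (Fin 6) (Fin 6) ℝ, A.PosSemidef ∧
      ∀ x y z, F x y z = quadMonomials x y z ⬝ᵥ A *ᵥ quadMonomials x y z := by
  obtain ⟨A, ⟨hA, hle⟩, hmax⟩ := (isCompact_gram_le F).exists_isMaxOn (f := trace)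
    ⟨0, .zero, by simpa using hpsd⟩ (by fun_prop)
  refine ⟨A, hA, ?_⟩
  by_contra! hne
  obtain ⟨x₀, y₀, z₀, hne⟩ := hne
  obtain ⟨q, ⟨a, b, c, d, e, f, hq⟩, ⟨x₁, y₁, z₁, hq_ne⟩, ε, hε, hqle⟩ :=
    (hF.add ((isTernaryQuartic_gram A).const_mul (-1))).dominatesSquare
      (fun x y z => by linarith [hle x y z]) ⟨x₀, y₀, z₀, fun h => hne (by linarith)⟩
  set u : Fin 6 → ℝ := ![c, e, f, a, d, b] with hu
  have hqu : ∀ x y z, q x y z = quadMonomials x y z ⬝ᵥ u := fun x y z => by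
    rw [hq]
    simp [hu, quadMonomials, dotProduct, Fin.sum_univ_six]
    ring
  have hu_ne : u ≠ 0 := by
    intro h
    simp [hqu, h] at hq_ne
  have hmem : A + ε • vecMulVec u (star u) ∈ {A : Matrix (Fin 6) (Fin 6) ℝ | A.PosSemidef ∧
      ∀ x y z, quadMonomials x y z ⬝ᵥ A *ᵥ quadMonomials x y z ≤ F x y z} := by
    refine ⟨hA.add ((posSemidef_vecMulVec_self_star u).smul hε.le), fun x y z => ?_⟩
    have h₁ := hqle x y z
    have h₂ : quadMonomials x y z ⬝ᵥ vecMulVec u (star u) *ᵥ quadMonomials x y z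
        = q x y z ^ 2 := by
      rw [hqu, vecMulVec_mulVec, star_trivial, dotProduct_comm u]
      simp [pow_two]
    rw [add_mulVec, smul_mulVec, dotProduct_add, dotProduct_smul, h₂, smul_eq_mul]
    linarith
  have htr : trace (A + ε • vecMulVec u (star u)) ≤ trace A := hmax hmem
  rw [trace_add, trace_smul, trace_vecMulVec, smul_eq_mul] at htr
  have : 0 < u ⬝ᵥ star u := dotProduct_star_self_pos_iff.2 hu_ne
  nlinarith

theorem Matrix.PosSemidef.sum_mul_nonneg {n : Type*} [Fintype n] {A B : Matrix n n ℝ}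
    (hA : A.PosSemidef) (hB : B.PosSemidef) : 0 ≤ ∑ i, ∑ j, A i j * B i j := by
  have := (hA.hadamard hB).dotProduct_mulVec_nonneg 1
  simpa [dotProduct, mulVec] using this

end Gram

section Moments

theorem coeff_eq_zero_of_sum_eq_zero {a : ℕ → ℝ}
    (h : ∀ t : ℝ, ∑ i ∈ Finset.range 5, a i * t ^ i = 0) : ∀ i ∈ Finset.range 5, a i = 0 := by
  have h₀ := h 0
  have h₁ := h 1
  have h₂ := h (-1)
  have h₃ := h 2
  have h₄ := h (-2)
  simp only [Finset.sum_range_succ, Finset.sum_range_zero] at h₀ h₁ h₂ h₃ h₄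
  norm_num at h₀ h₁ h₂ h₃ h₄
  intro i hi
  rw [Finset.mem_range] at hi
  interval_cases i <;> linarith

theorem coeff_eq_zero_of_evalPoly_eq_zero {e : ℕ → ℕ → ℝ} (h : ∀ x, evalPoly e x = 0) :
    ∀ i ∈ Finset.range 5, ∀ j ∈ Finset.range 5, e i j = 0 := by
  intro i hi
  refine coeff_eq_zero_of_sum_eq_zero fun y =>
    coeff_eq_zero_of_sum_eq_zero (a := fun i => ∑ j ∈ Finset.range 5, e i j * y ^ j)
      (fun x => ?_) i hi
  rw [← h (x, y)]
  simp only [evalPoly, Finset.sum_mul]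
  exact Finset.sum_congr rfl fun i _ => Finset.sum_congr rfl fun j _ => by ring

/-- The coefficients of the polynomial with Gram matrix `A`. -/
def gramCoeff (A : Matrix (Fin 6) (Fin 6) ℝ) (i j : ℕ) : ℝ :=
  ∑ a, ∑ b, if momIdx a + momIdx b = (i, j) then A a b else 0

theorem sum_gramCoeff_mul (A : Matrix (Fin 6) (Fin 6) ℝ) (φ : ℕ → ℕ → ℝ) :
    ∑ i ∈ Finset.range 5, ∑ j ∈ Finset.range 5, gramCoeff A i j * φ i j =
      ∑ a, ∑ b, A a b * φ ((momIdx a).1 + (momIdx b).1) ((momIdx a).2 + (momIdx b).2) := by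
  have hmem : ∀ a b, momIdx a + momIdx b ∈ Finset.range 5 ×ˢ Finset.range 5 := by decide
  rw [← Finset.sum_product' (f := fun i j => gramCoeff A i j * φ i j)]
  simp only [gramCoeff, Finset.sum_mul]
  rw [Finset.sum_comm]
  refine Finset.sum_congr rfl fun a _ => ?_
  rw [Finset.sum_comm]
  refine Finset.sum_congr rfl fun b _ => ?_
  simp only [ite_mul, zero_mul]
  rw [Finset.sum_ite_eq, if_pos (hmem a b)]
  rfl

theorem quadMonomials_one (x y : ℝ) (a : Fin 6) :
    quadMonomials x y 1 a = x ^ (momIdx a).1 * y ^ (momIdx a).2 := by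
  fin_cases a <;> simp [quadMonomials, momIdx]

/-- The Riesz functional of a positive semidefinite moment matrix is nonnegative on every
nonnegative bivariate quartic polynomial. -/
theorem riesz_nonneg {d y : ℕ → ℕ → ℝ} (hsupp : ∀ i j, 4 < i + j → d i j = 0)
    (hd : ∀ x, 0 ≤ evalPoly d x) (hy : (momMat y).PosSemidef) :
    0 ≤ ∑ i ∈ Finset.range 5, ∑ j ∈ Finset.range 5, d i j * y i j := by
  obtain ⟨F, hF⟩ : ∃ F : ℝ → ℝ → ℝ → ℝ, ∀ x y z, F x y z =
      d 4 0 * x ^ 4 + d 3 1 * (x ^ 3 * y) + d 3 0 * (x ^ 3 * z)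
      + d 2 2 * (x ^ 2 * y ^ 2) + d 2 1 * (x ^ 2 * (y * z)) + d 2 0 * (x ^ 2 * z ^ 2)
      + d 1 3 * (x * y ^ 3) + d 1 2 * (x * y * (y * z)) + d 1 1 * (x * y * z ^ 2)
      + d 1 0 * (x * z ^ 3) + d 0 4 * y ^ 4 + d 0 3 * (y ^ 3 * z) + d 0 2 * (y ^ 2 * z ^ 2)
      + d 0 1 * (y * z ^ 3) + d 0 0 * z ^ 4 := ⟨_, fun _ _ _ => rfl⟩
  have hF_quartic : IsTernaryQuartic F := ⟨_, _, _, _, _, _, _, _, _, _, _, _, _, _, _, hF⟩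
  have hF_one : ∀ x y, F x y 1 = evalPoly d (x, y) := fun x y => by
    rw [hF]
    simp [evalPoly, Finset.sum_range_succ, hsupp]
    ring
  have hF_ne : ∀ x y z, z ≠ 0 → 0 ≤ F x y z := fun x y z hz => by
    have h := hF_quartic.smul z (x / z) (y / z) 1
    rw [mul_div_cancel₀ _ hz, mul_div_cancel₀ _ hz, mul_one, hF_one] at h
    rw [h]
    have := hd (x / z, y / z)
    positivity
  have hF_nonneg : ∀ x y z, 0 ≤ F x y z := fun x y z => by
    by_cases hz : z = 0
    · subst hz
      exact nonneg_at_zero_of_nonneg_on_pos (φ := fun z => F x y z) (by simp only [hF]; fun_prop)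
        fun t ht => hF_ne x y t ht.ne'
    · exact hF_ne x y z hz
  obtain ⟨A, hA, hFA⟩ := hF_quartic.exists_posSemidef_gram hF_nonneg
  have hcoeff := coeff_eq_zero_of_evalPoly_eq_zero (e := fun i j => d i j - gramCoeff A i j)
    fun x => by
      have h₁ := sum_gramCoeff_mul A fun i j => x.1 ^ i * x.2 ^ j
      have h₂ := (hF_one x.1 x.2).symm.trans (hFA x.1 x.2 1)
      simp only [evalPoly, sub_mul, Finset.sum_sub_distrib] at h₂ ⊢
      simp only [mul_assoc] at h₂ ⊢
      rw [h₁, h₂, sub_eq_zero]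
      simp only [dotProduct, Matrix.mulVec, quadMonomials_one, Finset.mul_sum]
      exact Finset.sum_congr rfl fun i _ => Finset.sum_congr rfl fun j _ => by ring
  calc 0 ≤ ∑ a, ∑ b, A a b * momMat y a b := hA.sum_mul_nonneg hy
    _ = _ := (sum_gramCoeff_mul A y).symm
    _ = _ := Finset.sum_congr rfl fun i hi => Finset.sum_congr rfl fun j hj => by
      rw [sub_eq_zero.1 (hcoeff i hi j hj)]

theorem convex_lasserre2 (c : ℕ → ℕ → ℝ) : Convex ℝ (lasserre2 c) := by
  rintro x ⟨y, hy₀, hy₁, hy₂, hyc, hyM⟩ x' ⟨y', hy₀', hy₁', hy₂', hyc', hyM'⟩ s t hs ht hst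
  refine ⟨fun i j => s * y i j + t * y' i j, by simp [hy₀, hy₀', hst], by simp [hy₁, hy₁'],
    by simp [hy₂, hy₂'], ?_, ?_⟩
  · have : ∑ i ∈ Finset.range 5, ∑ j ∈ Finset.range 5, c i j * (s * y i j + t * y' i j)
        = s * ∑ i ∈ Finset.range 5, ∑ j ∈ Finset.range 5, c i j * y i j
          + t * ∑ i ∈ Finset.range 5, ∑ j ∈ Finset.range 5, c i j * y' i j := by
      simp only [Finset.mul_sum, ← Finset.sum_add_distrib]
      exact Finset.sum_congr rfl fun i _ => Finset.sum_congr rfl fun j _ => by ring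
    rw [this, hyc, hyc']
    simp
  · exact (hyM.smul hs).add (hyM'.smul ht)

theorem zeros_subset_lasserre2 (c : ℕ → ℕ → ℝ) : {x | evalPoly c x = 0} ⊆ lasserre2 c := by
  intro x hx
  have hx : evalPoly c x = 0 := hx
  refine ⟨fun i j => x.1 ^ i * x.2 ^ j, by simp, by simp, by simp, ?_, ?_⟩
  · simpa only [evalPoly, mul_assoc] using hx
  · convert Matrix.posSemidef_vecMulVec_self_star
      (fun a => x.1 ^ (momIdx a).1 * x.2 ^ (momIdx a).2) using 1
    ext a b
    simp only [momMat, Matrix.of_apply, Matrix.vecMulVec_apply, star_trivial]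
    ring

theorem sum_affine_sub_mul (c : ℕ → ℕ → ℝ) (f₀ f₁ f₂ t : ℝ) (φ : ℕ → ℕ → ℝ) :
    ∑ i ∈ Finset.range 5, ∑ j ∈ Finset.range 5,
      ((if (i, j) = (0, 0) then f₀ else if (i, j) = (1, 0) then f₁
        else if (i, j) = (0, 1) then f₂ else 0) - t * c i j) * φ i j =
      f₀ * φ 0 0 + f₁ * φ 1 0 + f₂ * φ 0 1
        - t * ∑ i ∈ Finset.range 5, ∑ j ∈ Finset.range 5, c i j * φ i j := by
  simp only [sub_mul, Finset.sum_sub_distrib, Finset.mul_sum, mul_assoc]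
  congr 1
  simp [Finset.sum_range_succ]
  ring

end Moments

/-- exactness of the first relaxation, Lemma 2: if every affine
polynomial `f` nonnegative on `P = conv C` admits a constant `t` such that
`f - t·p ≥ 0` on all of `ℝ²`, then `P` equals its first Lasserre relaxation `P₂`. -/
theorem lasserre2_exact (c : ℕ → ℕ → ℝ)
    (hsupp : ∀ i j : ℕ, 4 < i + j → c i j = 0)
    (hdeg : ∃ i j : ℕ, i + j = 4 ∧ c i j ≠ 0)
    (hne : {x : ℝ × ℝ | evalPoly c x = 0}.Nonempty)
    (hcompact : IsCompact (convexHull ℝ {x : ℝ × ℝ | evalPoly c x = 0}))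
    (hcert : ∀ f0 f1 f2 : ℝ,
      (∀ x ∈ convexHull ℝ {x : ℝ × ℝ | evalPoly c x = 0},
        0 ≤ f0 + f1 * x.1 + f2 * x.2) →
      ∃ t : ℝ, ∀ x : ℝ × ℝ, 0 ≤ (f0 + f1 * x.1 + f2 * x.2) - t * evalPoly c x) :
    convexHull ℝ {x : ℝ × ℝ | evalPoly c x = 0} = lasserre2 c := by
  refine Set.Subset.antisymm (convexHull_min (zeros_subset_lasserre2 c) (convex_lasserre2 c)) ?_
  rintro x ⟨y, hy₀, hy₁, hy₂, hyc, hyM⟩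
  by_contra hx
  obtain ⟨f, u, hfu, hux⟩ :=
    geometric_hahn_banach_point_closed (convex_convexHull ℝ _) hcompact.isClosed hx
  have hf : ∀ v : ℝ × ℝ, f v = f (1, 0) * v.1 + f (0, 1) * v.2 := fun v => by
    have hv : v = v.1 • ((1, 0) : ℝ × ℝ) + v.2 • ((0, 1) : ℝ × ℝ) := by
      ext <;> simp
    conv_lhs => rw [hv]
    simp only [map_add, map_smul, smul_eq_mul]
    ring
  obtain ⟨t, ht⟩ := hcert (-u) (f (1, 0)) (f (0, 1)) fun v hv => by
    have := hux v hv
    rw [hf] at this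
    linarith
  have hd := riesz_nonneg (y := y) (d := fun i j => (if (i, j) = (0, 0) then -u else
      if (i, j) = (1, 0) then f (1, 0) else if (i, j) = (0, 1) then f (0, 1) else 0) - t * c i j)
    (fun i j hij => by
      have h₁ : (i, j) ≠ (0, 0) := by rintro ⟨⟩; simp at hij
      have h₂ : (i, j) ≠ (1, 0) := by rintro ⟨⟩; simp at hij
      have h₃ : (i, j) ≠ (0, 1) := by rintro ⟨⟩; simp at hij
      simp only [h₁, h₂, h₃, if_false, hsupp i j hij, mul_zero, sub_zero])
    (fun v => by
      have h := ht v
      simp only [evalPoly, mul_assoc] at h ⊢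
      rw [sum_affine_sub_mul c _ _ _ _ fun i j => v.1 ^ i * v.2 ^ j]
      simpa using h) hyM
  rw [sum_affine_sub_mul, hyc, hy₀, hy₁, hy₂] at hd
  have := hf x
  linarith
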